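/- arXiv:1112.3397 — 2 statements merged into one kernel-verified Lean document; each statement's English description precedes it below -/
import Mathlib

section
/- Let (W,S) be a finitely generated Coxeter system acting geometrically on a proper CAT(0) space X, let x ∈ X be a point fixed by no nontrivial element of W, and let Λ_x be the copy of the Cayley graph Λ(W,S) at x with W-equivariant map P_x : Λ(W,S) → Λ_x. Then for each subset A ⊆ S, the special subgroup ⟨A⟩ is quasi-convex in X: there is a constant K such that every CAT(0) geodesic in X joining two points of the orbit ⟨A⟩x lies within distance K of ⟨A⟩x. -/
/-!
Common definitions: Cayley graph of a Coxeter system, walls, sides,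
bracket numbers, edge paths, quasi-geodesics, tracking.
-/

namespace CoxTrack

variable {B : Type*} {W : Type*} [Group W] {M : CoxeterMatrix B}

/-- The word metric on the Cayley graph `Λ(W,S)`: `d u v = ℓ(u⁻¹ v)`. -/
noncomputable def d (cs : CoxeterSystem M W) (u v : W) : ℕ := cs.length (u⁻¹ * v)

/-- `u` and `v` are adjacent vertices (endpoints of a common edge) of `Λ(W,S)`. -/
def Adj (cs : CoxeterSystem M W) (u v : W) : Prop := ∃ i : B, v = u * cs.simple i

/-- The edge with endpoints `u` and `v` belongs to the wall of the reflection `t`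
(i.e. `t` fixes this edge setwise, interchanging its endpoints). -/
def EdgeInWall (cs : CoxeterSystem M W) (t u v : W) : Prop :=
  Adj cs u v ∧ t * u = v

/-- `v` is a vertex of `Q̄`, the union of the edges of the wall of the reflection `t`. -/
def InWallBar (cs : CoxeterSystem M W) (t v : W) : Prop :=
  ∃ i : B, t * v = v * cs.simple i

/-- Vertices `u` and `v` lie on the same side of the wall of the reflection `t`. -/
def SameSide (cs : CoxeterSystem M W) (t u v : W) : Prop :=
  (cs.length (t * u) < cs.length u ↔ cs.length (t * v) < cs.length v)

/-- The wall of the reflection `t` separates the vertices `u` and `v`. -/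
def SeparatesPts (cs : CoxeterSystem M W) (t u v : W) : Prop := ¬ SameSide cs t u v

/-- The walls of the reflections `t` and `t'` are parallel: they are distinct and
all edges of each one lie on one side of the other. -/
def Parallel (cs : CoxeterSystem M W) (t t' : W) : Prop :=
  t ≠ t' ∧ (∀ u v, InWallBar cs t' u → InWallBar cs t' v → SameSide cs t u v)
         ∧ (∀ u v, InWallBar cs t u → InWallBar cs t v → SameSide cs t' u v)

/-- The walls of the reflections `t` and `t'` cross (they are distinct and not parallel). -/
def Crosses (cs : CoxeterSystem M W) (t t' : W) : Prop := t ≠ t' ∧ ¬ Parallel cs t t'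

/-- The wall of the reflection `r` separates `Q̄` (for the wall of the reflection `t`)
from the vertex `p`. -/
def SepWallFromPt (cs : CoxeterSystem M W) (r t p : W) : Prop :=
  ∀ v, InWallBar cs t v → SeparatesPts cs r v p

/-- The distance from the vertex `p` to `Q̄` (the wall of the reflection `t`),
measured to the nearest vertex of `Q̄`. -/
noncomputable def wallDist (cs : CoxeterSystem M W) (t p : W) : ℕ :=
  sInf {n : ℕ | ∃ v, InWallBar cs t v ∧ d cs p v = n}

/-- `v 0, v 1, …, v n` are the consecutive vertices of an edge path of length `n` in `Λ(W,S)`. -/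
def IsPath (cs : CoxeterSystem M W) (v : ℕ → W) (n : ℕ) : Prop :=
  ∀ k, k < n → Adj cs (v k) (v (k+1))

/-- `v 0, …, v n` are the consecutive vertices of a geodesic edge path of length `n`. -/
def IsGeodesic (cs : CoxeterSystem M W) (v : ℕ → W) (n : ℕ) : Prop :=
  IsPath cs v n ∧ d cs (v 0) (v n) = n

/-- `v 0, v 1, …` are the consecutive vertices of an edge path ray. -/
def IsRay (cs : CoxeterSystem M W) (v : ℕ → W) : Prop := ∀ k, Adj cs (v k) (v (k+1))

/-- A geodesic edge path ray. -/
def IsGeodesicRay (cs : CoxeterSystem M W) (v : ℕ → W) : Prop :=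
  IsRay cs v ∧ ∀ j k, j ≤ k → d cs (v j) (v k) = k - j

/-- `…, v (-1), v 0, v 1, …` are the consecutive vertices of an edge path line. -/
def IsLine (cs : CoxeterSystem M W) (v : ℤ → W) : Prop := ∀ k : ℤ, Adj cs (v k) (v (k+1))

/-- A geodesic edge path line. -/
def IsGeodesicLine (cs : CoxeterSystem M W) (v : ℤ → W) : Prop :=
  IsLine cs v ∧ ∀ j k : ℤ, j ≤ k → (d cs (v j) (v k) : ℤ) = k - j

/-- The set of (reflections of) walls bracketing the vertex `v k` of the edge path
`v 0, …, v n`: walls containing an edge of the path before `v k` and an edge after `v k`. -/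
def Brackets (cs : CoxeterSystem M W) (v : ℕ → W) (n k : ℕ) : Set W :=
  {t | ∃ j m, j < k ∧ k ≤ m ∧ m < n ∧
      EdgeInWall cs t (v j) (v (j+1)) ∧ EdgeInWall cs t (v m) (v (m+1))}

/-- The set of walls bracketing the vertex `v k` of the edge path ray `v`. -/
def BracketsRay (cs : CoxeterSystem M W) (v : ℕ → W) (k : ℕ) : Set W :=
  {t | ∃ j m, j < k ∧ k ≤ m ∧
      EdgeInWall cs t (v j) (v (j+1)) ∧ EdgeInWall cs t (v m) (v (m+1))}

/-- The set of walls bracketing the vertex `v k` of the edge path line `v`. -/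
def BracketsLine (cs : CoxeterSystem M W) (v : ℤ → W) (k : ℤ) : Set W :=
  {t | ∃ j m : ℤ, j < k ∧ k ≤ m ∧
      EdgeInWall cs t (v j) (v (j+1)) ∧ EdgeInWall cs t (v m) (v (m+1))}

/-- The edge path `v 0, …, v n` is a `(lam, eps)`-quasi-geodesic. -/
def IsQG (cs : CoxeterSystem M W) (lam eps : ℝ) (v : ℕ → W) (n : ℕ) : Prop :=
  IsPath cs v n ∧ ∀ j k, j ≤ n → k ≤ n →
    |(j : ℝ) - (k : ℝ)| ≤ lam * (d cs (v j) (v k) : ℝ) + eps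

/-- The edge path ray `v` is a `(lam, eps)`-quasi-geodesic. -/
def IsQGRay (cs : CoxeterSystem M W) (lam eps : ℝ) (v : ℕ → W) : Prop :=
  IsRay cs v ∧ ∀ j k : ℕ, |(j : ℝ) - (k : ℝ)| ≤ lam * (d cs (v j) (v k) : ℝ) + eps

/-- The edge path line `v` is a `(lam, eps)`-quasi-geodesic. -/
def IsQGLine (cs : CoxeterSystem M W) (lam eps : ℝ) (v : ℤ → W) : Prop :=
  IsLine cs v ∧ ∀ j k : ℤ, |(j : ℝ) - (k : ℝ)| ≤ lam * (d cs (v j) (v k) : ℝ) + eps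

/-- `P` is a Parallel Wall function for `(W,S)`: for each positive integer `n`, every wall `Q`
and every vertex `p` at distance at least `P n` from `Q̄`, there are `n` distinct pairwise
parallel walls separating `Q̄` from `p`. -/
def IsParallelWallFn (cs : CoxeterSystem M W) (P : ℕ → ℕ) : Prop :=
  ∀ n : ℕ, 0 < n → ∀ t p : W, cs.IsReflection t → P n ≤ wallDist cs t p →
    ∃ T : Finset W, T.card = n ∧ (∀ r ∈ T, cs.IsReflection r) ∧
      (∀ r ∈ T, ∀ r' ∈ T, r ≠ r' → Parallel cs r r') ∧
      (∀ r ∈ T, SepWallFromPt cs r t p)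

/-- `w 0, …, w m` (with distinguished approximation vertices `w (c 0), …, w (c n)`)
is an `L`-approximation of the edge path `v 0, …, v n`: it is an edge path with the
same endpoints, the segment from `w (c i)` to `w (c (i+1))` is geodesic, and the
approximation vertex `w (c i)` is within `L` of `v i`. -/
def IsApprox (cs : CoxeterSystem M W) (L : ℕ) (v : ℕ → W) (n : ℕ)
    (w : ℕ → W) (m : ℕ) (c : ℕ → ℕ) : Prop :=
  IsPath cs w m ∧ c 0 = 0 ∧ c n = m ∧ (∀ i, i < n → c i ≤ c (i+1)) ∧
  w 0 = v 0 ∧ w m = v n ∧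
  (∀ i, i ≤ n → d cs (w (c i)) (v i) ≤ L) ∧
  (∀ i, i < n → d cs (w (c i)) (w (c (i+1))) = c (i+1) - c i)

open Pointwise

/-- A proper metric space is CAT(0) if it has midpoints and satisfies the CN inequality
of Bruhat and Tits (equivalent to the comparison-triangle definition for complete
geodesic spaces). -/
def IsCAT0 (X : Type*) [MetricSpace X] : Prop :=
  (∀ x y : X, ∃ m : X, dist x m = dist x y / 2 ∧ dist m y = dist x y / 2) ∧
  (∀ x y z m : X, dist y m = dist y z / 2 → dist m z = dist y z / 2 →
    dist x m ^ 2 ≤ (dist x y ^ 2 + dist x z ^ 2) / 2 - dist y z ^ 2 / 4)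

section Cocycle

lemma functionEnd_mul_apply {α : Type*} (f g : Function.End α) (a : α) : (f * g) a = f (g a) := rfl

open Classical in
/-- Conjugation by `s i`, with a sign change at `s i` itself: the basic move on `W × ZMod 2`
from which the reflection cocycle is built. -/
noncomputable def simpleFlip (cs : CoxeterSystem M W) (i : B) : Function.End (W × ZMod 2) :=
  fun p => (cs.simple i * p.1 * cs.simple i, p.2 + if p.1 = cs.simple i then 1 else 0)

open Classical in
lemma simpleFlip_mul_simpleFlip_pow (cs : CoxeterSystem M W) (i j : B) (n : ℕ) (p : W × ZMod 2) :
    ((simpleFlip cs i * simpleFlip cs j) ^ n) p =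
      ((cs.simple i * cs.simple j) ^ n * p.1 * ((cs.simple i * cs.simple j) ^ n)⁻¹,
        p.2 + ∑ k ∈ Finset.range (2 * n),
          if p.1 = (cs.simple j * cs.simple i) ^ k * cs.simple j then 1 else 0) := by
  induction n with
  | zero => simp [Function.End.one_def]
  | succ n ih =>
    have hinv : (cs.simple i * cs.simple j)⁻¹ = cs.simple j * cs.simple i := by simp
    have hconj : ∀ n : ℕ, cs.simple j * (cs.simple i * cs.simple j) ^ n
        = (cs.simple j * cs.simple i) ^ n * cs.simple j := by
      intro n
      induction n with
      | zero => simp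
      | succ n ih => rw [pow_succ, ← mul_assoc, ih, pow_succ]; simp only [mul_assoc]
    have key : ∀ a : W, ((cs.simple i * cs.simple j) ^ n * p.1 *
        ((cs.simple i * cs.simple j) ^ n)⁻¹ = a) ↔
        p.1 = (cs.simple j * cs.simple i) ^ n * a * (cs.simple i * cs.simple j) ^ n := by
      intro a
      rw [← hinv, inv_pow]
      constructor
      · rintro rfl; group
      · intro h; rw [h]; group
    rw [pow_succ', functionEnd_mul_apply, ih, functionEnd_mul_apply]
    refine Prod.ext ?_ ?_
    · simp only [simpleFlip]
      rw [pow_succ', mul_inv_rev, hinv]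
      simp only [mul_assoc]
    · simp only [simpleFlip]
      rw [show 2 * (n + 1) = 2 * n + 1 + 1 by ring, Finset.sum_range_succ, Finset.sum_range_succ]
      have e1 : ((cs.simple i * cs.simple j) ^ n * p.1 *
          ((cs.simple i * cs.simple j) ^ n)⁻¹ = cs.simple j) ↔
          p.1 = (cs.simple j * cs.simple i) ^ (2 * n) * cs.simple j := by
        rw [key, mul_assoc, hconj, ← mul_assoc, ← pow_add, two_mul]
      have e2 : (cs.simple j * ((cs.simple i * cs.simple j) ^ n * p.1 *
          ((cs.simple i * cs.simple j) ^ n)⁻¹) * cs.simple j = cs.simple i) ↔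
          p.1 = (cs.simple j * cs.simple i) ^ (2 * n + 1) * cs.simple j := by
        have : ∀ a : W, cs.simple j * a * cs.simple j = cs.simple i ↔
            a = cs.simple j * cs.simple i * cs.simple j := by
          intro a
          constructor
          · intro h; rw [← h]; simp [mul_assoc]
          · rintro rfl; simp [mul_assoc]
        rw [this, key, mul_assoc, mul_assoc, hconj, ← mul_assoc, ← mul_assoc, ← pow_succ,
          ← pow_add, show n + 1 + n = 2 * n + 1 by ring]
      simp only [e1, e2, add_assoc]

lemma isLiftable_simpleFlip (cs : CoxeterSystem M W) : M.IsLiftable (simpleFlip cs) := by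
  classical
  intro i j
  funext p
  rw [simpleFlip_mul_simpleFlip_pow, cs.simple_mul_simple_pow, two_mul, Finset.sum_range_add]
  simp only [pow_add, cs.simple_mul_simple_pow', one_mul, inv_one, mul_one,
    CharTwo.add_self_eq_zero, add_zero]
  rfl

open Classical in
/-- The reflection cocycle: `η w t` is the parity of the number of times a path from
`1` to `w` crosses the wall of `t`. -/
theorem exists_reflection_cocycle (cs : CoxeterSystem M W) :
    ∃ η : W → W → ZMod 2, (∀ i t, η (cs.simple i) t = if t = cs.simple i then 1 else 0) ∧
      ∀ u v t, η (u * v) t = η u t + η v (u⁻¹ * t * u) := by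
  let φ : W →* Function.End (W × ZMod 2) := cs.lift ⟨simpleFlip cs, isLiftable_simpleFlip cs⟩
  have hs : ∀ i, φ (cs.simple i) = simpleFlip cs i := fun i =>
    cs.lift_apply_simple (isLiftable_simpleFlip cs) i
  have hφ : ∀ (w : W) (p : W × ZMod 2),
      φ w p = (w * p.1 * w⁻¹, p.2 + (φ w (p.1, 0)).2) := by
    intro w
    induction w using cs.simple_induction_left with
    | one => intro p; simp [Function.End.one_def]
    | mul_simple_left w i ih =>
      intro p
      rw [map_mul, hs, functionEnd_mul_apply, functionEnd_mul_apply, ih p, ih (p.1, 0)]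
      simp [simpleFlip, mul_assoc, add_assoc]
  refine ⟨fun w t => (φ w⁻¹ (t, 0)).2, fun i t => ?_, fun u v t => ?_⟩
  · simp [hs, simpleFlip]
  · simp only
    rw [mul_inv_rev, map_mul, functionEnd_mul_apply, hφ u⁻¹ (t, 0), hφ v⁻¹]
    simp

variable {cs : CoxeterSystem M W} {η : W → W → ZMod 2}

lemma cocycle_one (hmul : ∀ u v t, η (u * v) t = η u t + η v (u⁻¹ * t * u)) (t : W) :
    η 1 t = 0 := by
  simpa using hmul 1 1 t

open Classical in
lemma cocycle_wordProd (hs : ∀ i t, η (cs.simple i) t = if t = cs.simple i then 1 else 0)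
    (hmul : ∀ u v t, η (u * v) t = η u t + η v (u⁻¹ * t * u)) (ω : List B) (t : W) :
    η (cs.wordProd ω) t = ((cs.leftInvSeq ω).count t : ZMod 2) := by
  induction ω generalizing t with
  | nil => simp [cocycle_one hmul]
  | cons i ω ih =>
    have hc : t = MulAut.conj (cs.simple i) ((cs.simple i)⁻¹ * t * cs.simple i) := by
      simp [mul_assoc]
    rw [cs.wordProd_cons, hmul, hs, ih, CoxeterSystem.leftInvSeq, List.count_cons]
    conv_rhs => rw [hc, List.count_map_of_injective _ _ (MulAut.conj (cs.simple i)).injective, ← hc]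
    by_cases h : t = cs.simple i
    · simp [h, add_comm]
    · simp [h, Ne.symm h]

lemma cocycle_support_finite
    (hs : ∀ (i : B) (t : W), t ≠ cs.simple i → η (cs.simple i) t = 0)
    (hmul : ∀ u v t, η (u * v) t = η u t + η v (u⁻¹ * t * u)) (w : W) :
    {t | η w t ≠ 0}.Finite := by
  induction w using cs.simple_induction_left with
  | one => simp [cocycle_one hmul]
  | mul_simple_left w i ih =>
    refine ((Set.finite_singleton (cs.simple i)).union
      (ih.image fun t => cs.simple i * t * (cs.simple i)⁻¹)).subset fun t ht => ?_
    by_contra hcon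
    simp only [Set.mem_union, Set.mem_singleton_iff, Set.mem_image, Set.mem_ofPred_eq, not_or,
      not_exists, not_and] at hcon
    refine ht ?_
    rw [hmul, hs i t hcon.1, zero_add]
    by_contra h
    exact hcon.2 _ h (by group)

lemma mem_of_cocycle_ne_zero {A : Set B}
    (hs : ∀ (i : B) (t : W), t ≠ cs.simple i → η (cs.simple i) t = 0)
    (hmul : ∀ u v t, η (u * v) t = η u t + η v (u⁻¹ * t * u)) {a : W}
    (ha : a ∈ Subgroup.closure (cs.simple '' A)) {t : W} (ht : η a t ≠ 0) :
    t ∈ Subgroup.closure (cs.simple '' A) := by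
  induction ha using Subgroup.closure_induction generalizing t with
  | mem y hy =>
    obtain ⟨i, hi, rfl⟩ := hy
    have : t = cs.simple i := by
      by_contra h
      exact ht (hs i t h)
    rw [this]
    exact Subgroup.subset_closure ⟨i, hi, rfl⟩
  | one => exact absurd (cocycle_one hmul t) ht
  | mul u v hu hv ihu ihv =>
    rw [hmul] at ht
    by_cases h : η u t = 0
    · rw [h, zero_add] at ht
      have := mul_mem (mul_mem hu (ihv ht)) (inv_mem hu)
      convert this using 1
      group
    · exact ihu h
  | inv u hu ih =>
    have h1 := hmul u⁻¹ u t
    rw [inv_mul_cancel, cocycle_one hmul, inv_inv] at h1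
    have h2 : η u (u * t * u⁻¹) ≠ 0 := fun h => ht (by simpa [h] using h1.symm)
    have := mul_mem (mul_mem (inv_mem hu) (ih h2)) hu
    convert this using 1
    group

end Cocycle

section CAT0

variable {X : Type*} [MetricSpace X]

lemma isCompact_between [ProperSpace X] (p q : X) :
    IsCompact {y : X | dist p y + dist y q = dist p q} := by
  refine (isCompact_closedBall p (dist p q)).of_isClosed_subset
    (isClosed_eq ((continuous_const.dist continuous_id).add (continuous_id.dist continuous_const))
      continuous_const) fun y hy => ?_
  have h : dist p y + dist y q = dist p q := hy
  rw [Metric.mem_closedBall, dist_comm]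
  linarith [dist_nonneg (x := y) (y := q)]

/-- In a proper space with midpoints, a segment has points at every intermediate distance. -/
lemma IsCAT0.exists_between [ProperSpace X] (hX : IsCAT0 X) (p q : X) {a : ℝ} (ha : 0 ≤ a)
    (haq : a ≤ dist p q) :
    ∃ y, dist p y + dist y q = dist p q ∧ dist p y = a := by
  have hc1 : IsCompact {y : X | dist p y + dist y q = dist p q ∧ dist p y ≤ a} :=
    (isCompact_between p q).inter_right
      (isClosed_le (f := fun y => dist p y) (g := fun _ => a) (by fun_prop) (by fun_prop))
  obtain ⟨y₀, ⟨h0, h0a⟩, hmax⟩ := hc1.exists_isMaxOn ⟨p, by simpa using ha⟩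
    (f := fun y => dist p y) (by fun_prop)
  have hc2 : IsCompact {y : X | dist y₀ y + dist y q = dist y₀ q ∧ a ≤ dist p y} :=
    (isCompact_between y₀ q).inter_right
      (isClosed_le (f := fun _ => a) (g := fun y => dist p y) (by fun_prop) (by fun_prop))
  obtain ⟨y₁, ⟨h1, h1a⟩, hmin⟩ := hc2.exists_isMinOn ⟨q, by simpa using haq⟩
    (f := fun y => dist p y) (by fun_prop)
  have t1 := dist_triangle p y₀ y₁
  have t2 := dist_triangle p y₁ q
  have hb1 : dist p y₁ + dist y₁ q = dist p q := by linarith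
  have hb01 : dist p y₁ = dist p y₀ + dist y₀ y₁ := by linarith
  obtain ⟨m, hm0, hm1⟩ := hX.1 y₀ y₁
  have t3 := dist_triangle p y₀ m
  have t4 := dist_triangle p m y₁
  have t5 := dist_triangle m y₁ q
  have t6 := dist_triangle y₀ m q
  have hpm : dist p m = dist p y₀ + dist y₀ y₁ / 2 := by linarith
  rcases le_total (dist p m) a with h | h
  · have : dist p m ≤ dist p y₀ := hmax ⟨by linarith [dist_triangle p m q], h⟩
    have := dist_nonneg (x := y₀) (y := y₁)
    exact ⟨y₀, h0, by linarith⟩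
  · have : dist p y₁ ≤ dist p m := hmin ⟨by linarith, h⟩
    have := dist_nonneg (x := y₀) (y := y₁)
    exact ⟨y₁, hb1, by linarith⟩

/-- The segment joining the midpoints of two sides of a triangle is at most half the third. -/
lemma IsCAT0.dist_midpoints_le (hX : IsCAT0 X) {a b c m n : X}
    (hm1 : dist a m = dist a b / 2) (hm2 : dist m b = dist a b / 2)
    (hn1 : dist a n = dist a c / 2) (hn2 : dist n c = dist a c / 2) :
    dist m n ≤ dist b c / 2 := by
  have h1 := hX.2 m a c n hn1 hn2
  have h2 := hX.2 c a b m hm1 hm2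
  rw [dist_comm m a, hm1] at h1
  rw [dist_comm c m, dist_comm c a, dist_comm c b] at h2
  refine le_of_sq_le_sq ?_ (by positivity)
  nlinarith

lemma IsCAT0.dist_map_midpoint_le (hX : IsCAT0 X) {f : X → X} (hf : Isometry f) {a b m : X}
    (hm1 : dist a m = dist a b / 2) (hm2 : dist m b = dist a b / 2) :
    dist (f m) m ≤ (dist (f a) a + dist (f b) b) / 2 := by
  obtain ⟨n, hn1, hn2⟩ := hX.1 a (f b)
  have h1 := hX.dist_midpoints_le hm1 hm2 hn1 hn2
  have h2 := hX.dist_midpoints_le (a := f b) (b := a) (c := f a) (m := n) (n := f m)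
    (by rw [dist_comm, hn2, dist_comm a]) (by rw [dist_comm, hn1, dist_comm a])
    (by rw [hf.dist_eq, hf.dist_eq, dist_comm, hm2, dist_comm a])
    (by rw [hf.dist_eq, hf.dist_eq, dist_comm, hm1, dist_comm a])
  have h3 := dist_triangle m n (f m)
  rw [dist_comm m (f m)] at h3
  rw [dist_comm b (f b)] at h1
  rw [dist_comm a (f a)] at h2
  linarith

/-- The displacement of an isometry of a proper CAT(0) space is bounded along a geodesic by its bound at the ends. -/
lemma IsCAT0.dist_map_le [ProperSpace X] (hX : IsCAT0 X) {f : X → X} (hf : Isometry f)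
    {y y' z : X} {C : ℝ} (hz : dist y z + dist z y' = dist y y')
    (hy : dist (f y) y ≤ C) (hy' : dist (f y') y' ≤ C) : dist (f z) z ≤ C := by
  have hfc := hf.continuous
  obtain ⟨m, hm, hmax⟩ := (isCompact_between y y').exists_isMaxOn ⟨z, hz⟩
    (f := fun w => dist (f w) w) (by fun_prop)
  have hmb : dist y m + dist m y' = dist y y' := hm
  have hzm : dist (f z) z ≤ dist (f m) m := hmax hz
  suffices dist (f m) m ≤ C by linarith
  rcases le_total (dist y m) (dist m y') with h | h
  · obtain ⟨e, he, hed⟩ := hX.exists_between m y' dist_nonneg h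
    have t1 := dist_triangle y m e
    have t2 := dist_triangle y e y'
    have hle : dist (f e) e ≤ dist (f m) m := hmax (show dist y e + dist e y' = _ by linarith)
    have := hX.dist_map_midpoint_le hf (a := y) (b := e) (m := m) (by linarith) (by linarith)
    linarith
  · obtain ⟨e, he, hed⟩ := hX.exists_between m y dist_nonneg (a := dist m y')
      (by rw [dist_comm m y]; exact h)
    rw [dist_comm m y, dist_comm e y] at he
    have c := dist_comm e m
    have t1 := dist_triangle e m y'
    have t2 := dist_triangle y e y'
    have hle : dist (f e) e ≤ dist (f m) m := hmax (show dist y e + dist e y' = _ by linarith)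
    have := hX.dist_map_midpoint_le hf (a := e) (b := y') (m := m) (by linarith) (by linarith)
    linarith

end CAT0

section Action

variable {X : Type*} [MetricSpace X] [MulAction W X]

/-- If `v • x` and `u • x` are close to the ends of a geodesic and the wall of `t` separates
`v` from `u`, then `t` moves some point of the geodesic a bounded distance. -/
lemma exists_dist_smul_le_of_cocycle_ne {η : W → W → ZMod 2} (hX : IsCAT0 X)
    (hiso : ∀ w : W, Isometry (fun y : X => w • y))
    (hmul : ∀ u v t, η (u * v) t = η u t + η v (u⁻¹ * t * u)) {x : X} {R C : ℝ}
    (hR : ∀ y : X, ∃ w : W, dist y (w • x) ≤ R)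
    (hC : ∀ f t : W, dist (f • x) x ≤ 2 * R + 1 → η f t ≠ 0 → dist (t • x) x ≤ C)
    (n : ℕ) (p q : X) (v u t : W) (hpq : dist p q ≤ 2 ^ n) (hp : dist p (v • x) ≤ R)
    (hq : dist q (u • x) ≤ R) (ht : η v t ≠ η u t) :
    ∃ y, dist p y + dist y q = dist p q ∧ dist (t • y) y ≤ C + 2 * R := by
  induction n generalizing p q v u with
  | zero =>
    refine ⟨p, by simp, ?_⟩
    have h1 : dist ((v⁻¹ * u) • x) x ≤ 2 * R + 1 := by
      rw [← (hiso v).dist_eq]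
      simp only [smul_smul, mul_inv_cancel_left]
      have t1 := dist_triangle (u • x) q (v • x)
      have t2 := dist_triangle q p (v • x)
      rw [dist_comm q p] at t2
      rw [dist_comm (u • x) q] at t1
      linarith
    have h2 : η (v⁻¹ * u) (v⁻¹ * t * v) ≠ 0 := by
      intro h
      have h3 := hmul v (v⁻¹ * u) t
      rw [h, add_zero, mul_inv_cancel_left] at h3
      exact ht h3.symm
    have h3 := hC _ _ h1 h2
    rw [← (hiso v).dist_eq] at h3
    simp only [smul_smul, mul_assoc, mul_inv_cancel_left] at h3
    have h4 : dist (t • p) ((t * v) • x) = dist p (v • x) := by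
      rw [mul_smul]; exact (hiso t).dist_eq _ _
    have t1 := dist_triangle4 (t • p) ((t * v) • x) (v • x) p
    rw [dist_comm (v • x) p] at t1
    linarith
  | succ n ih =>
    obtain ⟨m, hm1, hm2⟩ := hX.1 p q
    obtain ⟨w, hw⟩ := hR m
    rw [pow_succ] at hpq
    by_cases h : η v t = η w t
    · obtain ⟨y, hy, hty⟩ := ih m q w u (by linarith) hw hq (h ▸ ht)
      refine ⟨y, ?_, hty⟩
      linarith [dist_triangle p m y, dist_triangle p y q]
    · obtain ⟨y, hy, hty⟩ := ih p m v w (by linarith) hp hw h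
      refine ⟨y, ?_, hty⟩
      linarith [dist_triangle y m q, dist_triangle p y q]

lemma dist_smul_le_length_mul (cs : CoxeterSystem M W)
    (hiso : ∀ w : W, Isometry (fun y : X => w • y)) {x : X} {σ : ℝ}
    (hσ : ∀ i, dist (cs.simple i • x) x ≤ σ) (w : W) :
    dist (w • x) x ≤ cs.length w * σ := by
  obtain ⟨ω, hω, rfl⟩ := cs.exists_isReduced w
  rw [hω.eq]
  clear hω
  induction ω with
  | nil => simp
  | cons i ω ih =>
    rw [cs.wordProd_cons, mul_smul, List.length_cons]
    have h1 := (hiso (cs.simple i)).dist_eq (cs.wordProd ω • x) x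
    have h2 := dist_triangle (cs.simple i • cs.wordProd ω • x) (cs.simple i • x) x
    have := hσ i
    push_cast
    linarith

lemma finite_dist_smul_le [ProperSpace X]
    (hpd : ∀ C : Set X, IsCompact C → {w : W | (w • C) ∩ C ≠ ∅}.Finite) (x : X) (r : ℝ) :
    {w : W | dist (w • x) x ≤ r}.Finite := by
  refine (hpd _ (isCompact_closedBall x r)).subset fun w hw => ?_
  have hw' : dist (w • x) x ≤ r := hw
  have hr : 0 ≤ r := dist_nonneg.trans hw'
  exact Set.Nonempty.ne_empty
    ⟨w • x, Set.smul_mem_smul_set (Metric.mem_closedBall_self hr), hw'⟩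

end Action

/-- Suppose the Coxeter group `W` of the system `(W,S)` acts geometrically on a proper
CAT(0) space `X` and `x ∈ X` is fixed by no nontrivial element of `W`. Then for each
`A ⊆ S` the special subgroup `⟨A⟩` is quasi-convex in `X`: there is `K` such that every
point on a CAT(0) geodesic joining two points of the orbit `⟨A⟩x` is within `K` of the
orbit `⟨A⟩x`. -/
theorem special_subgroup_quasiconvex {B : Type*} {W : Type*} [Group W] [Finite B]
    {M : CoxeterMatrix B} (cs : CoxeterSystem M W)
    (X : Type*) [MetricSpace X] [ProperSpace X] (hX : IsCAT0 X)
    [MulAction W X]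
    (hiso : ∀ w : W, Isometry (fun y : X => w • y))
    (hpd : ∀ C : Set X, IsCompact C → {w : W | (w • C) ∩ C ≠ ∅}.Finite)
    (hcc : ∃ C : Set X, IsCompact C ∧ ⋃ w : W, w • C = Set.univ)
    (x : X) (hx : ∀ w : W, w • x = x → w = 1) :
    ∀ A : Set B, ∃ K : ℝ, ∀ w₁ w₂ : W,
      w₁ ∈ Subgroup.closure (cs.simple '' A) → w₂ ∈ Subgroup.closure (cs.simple '' A) →
      ∀ z : X, dist (w₁ • x) z + dist z (w₂ • x) = dist (w₁ • x) (w₂ • x) →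
        ∃ w ∈ Subgroup.closure (cs.simple '' A), dist z (w • x) ≤ K := by
  classical
  intro A
  obtain ⟨η, hs, hmul⟩ := exists_reflection_cocycle cs
  have hs' : ∀ (i : B) (t : W), t ≠ cs.simple i → η (cs.simple i) t = 0 :=
    fun i t h => by rw [hs, if_neg h]
  set H := Subgroup.closure (cs.simple '' A)
  obtain ⟨R, hR⟩ : ∃ R : ℝ, ∀ y : X, ∃ w : W, dist y (w • x) ≤ R := by
    obtain ⟨D, hD, hcov⟩ := hcc
    obtain ⟨R, hDR⟩ := hD.isBounded.subset_closedBall x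
    refine ⟨R, fun y => ?_⟩
    have hy : y ∈ ⋃ w : W, w • D := hcov ▸ Set.mem_univ y
    obtain ⟨w, c, hc, rfl⟩ := Set.mem_iUnion.mp hy
    exact ⟨w, ((hiso w).dist_eq c x).trans_le (hDR hc)⟩
  obtain ⟨C, hC⟩ : ∃ C : ℝ, ∀ f t : W, dist (f • x) x ≤ 2 * R + 1 → η f t ≠ 0 →
      dist (t • x) x ≤ C := by
    have hfin := (finite_dist_smul_le hpd x (2 * R + 1)).biUnion
      fun f _ => cocycle_support_finite hs' hmul f
    obtain ⟨C, hC⟩ := (hfin.image fun t => dist (t • x) x).bddAbove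
    exact ⟨C, fun f t hf ht => hC ⟨t, Set.mem_biUnion hf ht, rfl⟩⟩
  obtain ⟨σ, hσ⟩ : ∃ σ : ℝ, ∀ i, dist (cs.simple i • x) x ≤ σ := by
    obtain ⟨σ, hσ⟩ := (Set.finite_range fun i => dist (cs.simple i • x) x).bddAbove
    exact ⟨σ, fun i => hσ ⟨i, rfl⟩⟩
  have hG := finite_dist_smul_le hpd x (C + 4 * R)
  set N := hG.toFinset.card
  have hlen : ∀ w₁ ∈ H, ∀ w₂ ∈ H, ∀ (z : X) (u : W),
      dist (w₁ • x) z + dist z (w₂ • x) = dist (w₁ • x) (w₂ • x) → dist z (u • x) ≤ R →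
      (∀ a ∈ H, cs.length u ≤ cs.length (a * u)) → cs.length u ≤ N := by
    intro w₁ h₁ w₂ h₂ z u hz hu hmin
    have hR0 : 0 ≤ R := dist_nonneg.trans hu
    obtain ⟨ω, hω, rfl⟩ := cs.exists_isReduced u
    rw [hω.eq, ← cs.length_leftInvSeq, ← List.toFinset_card_of_nodup hω.nodup_leftInvSeq]
    refine Finset.card_le_card_of_injOn
      (fun t => (cs.wordProd ω)⁻¹ * t * cs.wordProd ω) (fun t ht => ?_)
      (fun t _ t' _ h => by simpa using h)
    rw [Finset.mem_coe, List.mem_toFinset] at ht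
    have hηu : η (cs.wordProd ω) t ≠ 0 := by
      rw [cocycle_wordProd hs hmul, List.count_eq_one_of_mem hω.nodup_leftInvSeq ht]
      simp
    have htH : t ∉ H := fun h =>
      (hmin t h).not_gt (cs.isLeftInversion_of_mem_leftInvSeq hω ht).2
    have hη : ∀ w ∈ H, η w t = 0 := fun w hw => by
      by_contra h
      exact htH (mem_of_cocycle_ne_zero hs' hmul hw h)
    obtain ⟨n₁, hn₁⟩ := pow_unbounded_of_one_lt (dist (w₁ • x) z) (one_lt_two (α := ℝ))
    obtain ⟨n₂, hn₂⟩ := pow_unbounded_of_one_lt (dist z (w₂ • x)) (one_lt_two (α := ℝ))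
    obtain ⟨y, hy, hty⟩ := exists_dist_smul_le_of_cocycle_ne hX hiso hmul hR hC n₁
      (w₁ • x) z w₁ (cs.wordProd ω) t hn₁.le (by simpa using hR0) hu
      (by rw [hη w₁ h₁]; exact hηu.symm)
    obtain ⟨y', hy', hty'⟩ := exists_dist_smul_le_of_cocycle_ne hX hiso hmul hR hC n₂
      z (w₂ • x) (cs.wordProd ω) w₂ t hn₂.le hu (by simpa using hR0)
      (by rw [hη w₂ h₂]; exact hηu)
    have hbet : dist y z + dist z y' = dist y y' := by
      linarith [dist_triangle y z y', dist_triangle4 (w₁ • x) y y' (w₂ • x)]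
    have htz := hX.dist_map_le (hiso t) hbet hty hty'
    rw [Finset.mem_coe, Set.Finite.mem_toFinset]
    change dist _ _ ≤ _
    rw [← (hiso (cs.wordProd ω)).dist_eq]
    simp only [smul_smul, mul_assoc, mul_inv_cancel_left]
    rw [mul_smul]
    have e := (hiso t).dist_eq (cs.wordProd ω • x) z
    have t1 := dist_triangle4 (t • cs.wordProd ω • x) (t • z) z (cs.wordProd ω • x)
    rw [dist_comm _ z] at e
    linarith
  refine ⟨R + N * |σ|, fun w₁ w₂ h₁ h₂ z hz => ?_⟩
  obtain ⟨u, hu⟩ := hR z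
  obtain ⟨a, ha, hamin⟩ : ∃ a ∈ H, ∀ b ∈ H, cs.length (a * u) ≤ cs.length (b * u) := by
    let a := Function.argmin (fun b : H => cs.length (b.1 * u))
    exact ⟨a, a.2, fun b hb => Function.argmin_le (fun b : H => cs.length (b.1 * u)) ⟨b, hb⟩⟩
  have hl := hlen (a * w₁) (mul_mem ha h₁) (a * w₂) (mul_mem ha h₂) (a • z) (a * u)
    (by simpa only [mul_smul, (hiso a).dist_eq] using hz)
    (by rw [mul_smul]; exact ((hiso a).dist_eq z (u • x)).trans_le hu)
    (fun b hb => by rw [← mul_assoc]; exact hamin _ (mul_mem hb ha))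
  refine ⟨a⁻¹, inv_mem ha, ?_⟩
  have hd := dist_smul_le_length_mul cs hiso hσ (a * u)
  have hd' : dist (u • x) (a⁻¹ • x) = dist ((a * u) • x) x := by
    rw [← (hiso a).dist_eq]
    simp only [smul_smul, mul_inv_cancel, one_smul]
  have hl' : (cs.length (a * u) : ℝ) * σ ≤ N * |σ| :=
    (mul_le_mul_of_nonneg_left (le_abs_self σ) (Nat.cast_nonneg _)).trans
      (mul_le_mul_of_nonneg_right (by exact_mod_cast hl) (abs_nonneg σ))
  linarith [dist_triangle z (u • x) (a⁻¹ • x)]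

end CoxTrack
end

section
/- Let (W,S) be a finitely generated Coxeter system and let g ∈ W be an element of infinite order. Then in the Cayley graph Λ(W,S) the set of elements {…, g⁻², g⁻¹, 1, g, g², …} is tracked by a Cayley graph geodesic: there exist a constant K and a geodesic edge path line β in Λ(W,S) such that for every integer n, the vertex gⁿ is within word-metric distance K of a vertex of β. -/
/-!
Common definitions: Cayley graph of a Coxeter system, walls, sides,
bracket numbers, edge paths, quasi-geodesics, tracking.
-/

namespace CoxTrack

variable {B : Type*} {W : Type*} [Group W] {M : CoxeterMatrix B}

section Reflections

open Classical in
/-- The action of a simple reflection on pairs consisting of a group element (to be conjugated) and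
a sign (to be flipped when the element is that simple reflection). -/
noncomputable def signedConj (cs : CoxeterSystem M W) (i : B) : Function.End (W × ZMod 2) :=
  fun p ↦ (cs.simple i * p.1 * (cs.simple i)⁻¹, p.2 + if p.1 = cs.simple i then 1 else 0)

open Classical in
theorem signedConj_mul_pow_apply (cs : CoxeterSystem M W) (i j : B) (n : ℕ) (p : W × ZMod 2) :
    ((signedConj cs i * signedConj cs j) ^ n) p =
      ((cs.simple i * cs.simple j) ^ n * p.1 * ((cs.simple i * cs.simple j) ^ n)⁻¹,
        p.2 + ∑ l ∈ Finset.range (2 * n),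
          if (cs.simple i * cs.simple j) ^ l * p.1 = cs.simple j then 1 else 0) := by
  set r := cs.simple i * cs.simple j with hr
  have hswap : ∀ k : ℕ, cs.simple j * r ^ k = (r ^ k)⁻¹ * cs.simple j := by
    intro k
    have h : cs.simple j * r * (cs.simple j)⁻¹ = r⁻¹ := by simp [hr, mul_assoc]
    have := congrArg (· ^ k) h
    simp only [conj_pow, inv_pow] at this
    rw [← this]; simp
  induction n with
  | zero => simp; rfl
  | succ n ih =>
    rw [pow_succ']
    change signedConj cs i (signedConj cs j (((signedConj cs i * signedConj cs j) ^ n) p)) = _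
    rw [ih]
    have h1 : (r ^ n * p.1 * (r ^ n)⁻¹ = cs.simple j) ↔ r ^ (2 * n) * p.1 = cs.simple j := by
      rw [mul_inv_eq_iff_eq_mul, hswap, eq_inv_mul_iff_mul_eq, ← mul_assoc, ← pow_add, two_mul]
    have h2 : (cs.simple j * (r ^ n * p.1 * (r ^ n)⁻¹) * (cs.simple j)⁻¹ = cs.simple i) ↔
        r ^ (2 * n + 1) * p.1 = cs.simple j := by
      have e : r ^ (2 * n + 1) * p.1 = r ^ (n + 1) * (r ^ n * p.1) := by
        rw [← mul_assoc, ← pow_add]; congr 2; omega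
      rw [e, mul_inv_eq_iff_eq_mul, ← hr, ← mul_assoc, mul_inv_eq_iff_eq_mul]
      conv_lhs => rw [← pow_succ', ← mul_right_inj (cs.simple j)]
      rw [hswap (n + 1), eq_inv_mul_iff_mul_eq, ← mul_assoc (cs.simple j) (cs.simple j)]
      simp
    simp only [signedConj]
    rw [show 2 * (n + 1) = 2 * n + 1 + 1 by ring, Finset.sum_range_succ, Finset.sum_range_succ]
    simp only [h1, h2]
    ext
    · simp [hr, pow_succ', mul_assoc]
    · simp [add_assoc]

theorem isLiftable_signedConj (cs : CoxeterSystem M W) : M.IsLiftable (signedConj cs) := by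
  classical
  intro i j
  funext p
  rw [signedConj_mul_pow_apply, cs.simple_mul_simple_pow, two_mul, Finset.sum_range_add]
  simp only [pow_add, cs.simple_mul_simple_pow, one_mul, CharTwo.add_self_eq_zero]
  simp; rfl

/-- The homomorphism by which `W` acts on pairs of a group element and a sign. -/
noncomputable def signedConjHom (cs : CoxeterSystem M W) : W →* Function.End (W × ZMod 2) :=
  cs.lift ⟨signedConj cs, isLiftable_signedConj cs⟩

/-- The parity of the number of times `t` occurs in the right inversion sequence of a word
representing `w`. -/
noncomputable def invParity (cs : CoxeterSystem M W) (w t : W) : ZMod 2 :=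
  (signedConjHom cs w (t, 0)).2

theorem signedConjHom_simple (cs : CoxeterSystem M W) (i : B) :
    signedConjHom cs (cs.simple i) = signedConj cs i :=
  cs.lift_apply_simple (isLiftable_signedConj cs) i

theorem signedConjHom_apply (cs : CoxeterSystem M W) (w t : W) (e : ZMod 2) :
    signedConjHom cs w (t, e) = (w * t * w⁻¹, e + invParity cs w t) := by
  unfold invParity
  induction w using cs.simple_induction_left generalizing e with
  | one => simp [Function.End.one_def]
  | mul_simple_left w i ih =>
    have h : ∀ p, signedConjHom cs (cs.simple i * w) p = signedConj cs i (signedConjHom cs w p) :=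
      fun p ↦ by rw [map_mul, signedConjHom_simple]; rfl
    have h0 : (signedConjHom cs w (t, 0)).1 = w * t * w⁻¹ := congrArg Prod.fst (ih 0)
    obtain ⟨c, hc⟩ : ∃ c, signedConjHom cs w (t, 0) = (w * t * w⁻¹, c) := ⟨_, Prod.ext h0 rfl⟩
    rw [h, h, ih e, hc]
    simp [signedConj, mul_assoc, add_assoc]

theorem invParity_mul (cs : CoxeterSystem M W) (w w' t : W) :
    invParity cs (w * w') t = invParity cs w' t + invParity cs w (w' * t * w'⁻¹) := by
  have h : signedConjHom cs (w * w') (t, 0) = signedConjHom cs w (signedConjHom cs w' (t, 0)) := by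
    rw [map_mul]; rfl
  rw [invParity, h, signedConjHom_apply, signedConjHom_apply, zero_add]

theorem invParity_one (cs : CoxeterSystem M W) (t : W) : invParity cs 1 t = 0 := by
  simp [invParity, Function.End.one_def]

theorem invParity_simple_self (cs : CoxeterSystem M W) (i : B) :
    invParity cs (cs.simple i) (cs.simple i) = 1 := by
  simp [invParity, signedConjHom_simple, signedConj]

theorem invParity_self (cs : CoxeterSystem M W) {t : W} (ht : cs.IsReflection t) :
    invParity cs t t = 1 := by
  obtain ⟨w, i, rfl⟩ := ht
  have h := invParity_mul cs w⁻¹ w (cs.simple i)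
  have h' := invParity_mul cs w w⁻¹ (w * cs.simple i * w⁻¹)
  rw [mul_inv_cancel, invParity_one] at h'
  rw [invParity_mul, invParity_mul]
  simp only [inv_inv, mul_assoc, inv_mul_cancel_left, inv_mul_cancel, mul_one,
    one_mul, cs.inv_simple, cs.simple_mul_simple_self, invParity_simple_self] at h' ⊢
  rw [add_left_comm, ← h', add_zero]

theorem mem_rightInvSeq_of_invParity_ne_zero (cs : CoxeterSystem M W) {ω : List B} {t : W}
    (h : invParity cs (cs.wordProd ω) t ≠ 0) : t ∈ cs.rightInvSeq ω := by
  induction ω with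
  | nil => simp [invParity_one] at h
  | cons i ω ih =>
    rw [CoxeterSystem.rightInvSeq, List.mem_cons, or_iff_not_imp_right]
    intro hmem
    rw [cs.wordProd_cons, invParity_mul, not_ne_iff.1 (mt ih hmem), zero_add] at h
    have h' : cs.wordProd ω * t * (cs.wordProd ω)⁻¹ = cs.simple i := by
      by_contra hne
      simp [invParity, signedConjHom_simple, signedConj, hne] at h
    rw [← h']
    group

theorem invParity_ne_zero_iff (cs : CoxeterSystem M W) {t : W} (ht : cs.IsReflection t) (w : W) :
    invParity cs w t ≠ 0 ↔ cs.length (w * t) < cs.length w := by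
  have key : ∀ v : W, invParity cs v t ≠ 0 → cs.length (v * t) < cs.length v := by
    intro v hv
    obtain ⟨ω, hω, rfl⟩ := cs.exists_isReduced v
    exact (cs.isRightInversion_of_mem_rightInvSeq hω
      (mem_rightInvSeq_of_invParity_ne_zero cs hv)).2
  refine ⟨key w, fun h h0 ↦ ?_⟩
  have hwt := key (w * t) (by simp [invParity_mul, invParity_self cs ht, h0])
  rw [mul_assoc, ht.mul_self, mul_one] at hwt
  omega

theorem setOf_isRightInversion (cs : CoxeterSystem M W) {ω : List B} (hω : cs.IsReduced ω) :
    {t | cs.IsRightInversion (cs.wordProd ω) t} = {t | t ∈ cs.rightInvSeq ω} :=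
  Set.ext fun _ ↦ ⟨fun h ↦ mem_rightInvSeq_of_invParity_ne_zero cs
    ((invParity_ne_zero_iff cs h.1 _).2 h.2), cs.isRightInversion_of_mem_rightInvSeq hω⟩

theorem finite_setOf_isRightInversion (cs : CoxeterSystem M W) (w : W) :
    {t | cs.IsRightInversion w t}.Finite := by
  obtain ⟨ω, hω, rfl⟩ := cs.exists_isReduced w
  rw [setOf_isRightInversion cs hω]
  exact List.finite_toSet _

theorem ncard_setOf_isRightInversion (cs : CoxeterSystem M W) (w : W) :
    {t | cs.IsRightInversion w t}.ncard = cs.length w := by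
  classical
  obtain ⟨ω, hω, rfl⟩ := cs.exists_isReduced w
  rw [setOf_isRightInversion cs hω, ← List.coe_toFinset, Set.ncard_coe_finset,
    List.toFinset_card_of_nodup hω.nodup_rightInvSeq, cs.length_rightInvSeq, hω.eq]

end Reflections

section Walls

theorem d_mul_left (cs : CoxeterSystem M W) (g u v : W) : d cs (g * u) (g * v) = d cs u v := by
  simp [d, mul_assoc]

theorem d_comm (cs : CoxeterSystem M W) (u v : W) : d cs u v = d cs v u := by
  rw [d, d, ← cs.length_inv]; simp

theorem d_triangle (cs : CoxeterSystem M W) (u v w : W) : d cs u w ≤ d cs u v + d cs v w := by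
  simpa [d, mul_assoc] using cs.length_mul_le (u⁻¹ * v) (v⁻¹ * w)

theorem sameSide_iff_invParity (cs : CoxeterSystem M W) {t : W} (ht : cs.IsReflection t)
    (u v : W) : SameSide cs t u v ↔ invParity cs u⁻¹ t = invParity cs v⁻¹ t := by
  have h : ∀ w : W, cs.length (t * w) < cs.length w ↔ invParity cs w⁻¹ t ≠ 0 := fun w ↦ by
    rw [invParity_ne_zero_iff cs ht, ← cs.length_inv (t * w), ← cs.length_inv w, mul_inv_rev,
      ht.inv]
  rw [SameSide, h, h]
  generalize invParity cs u⁻¹ t = a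
  generalize invParity cs v⁻¹ t = b
  revert a b
  decide

/-- A wall separates `u` from `v` exactly when reflecting `u` in it moves `u` closer to `v`. -/
theorem separatesPts_iff (cs : CoxeterSystem M W) {t : W} (ht : cs.IsReflection t) (u v : W) :
    SeparatesPts cs t u v ↔ d cs (t * u) v < d cs u v := by
  have hr : cs.IsReflection (u⁻¹ * t * u) := by simpa using ht.conj u⁻¹
  have h := invParity_mul cs (v⁻¹ * u) u⁻¹ t
  rw [inv_inv, mul_assoc v⁻¹, mul_inv_cancel, mul_one] at h
  rw [SeparatesPts, sameSide_iff_invParity cs ht, h, left_eq_add, ← ne_eq,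
    invParity_ne_zero_iff cs hr, d_comm cs _ v, d_comm cs u v]
  simp [d, mul_assoc]

theorem separatesPts_conj (cs : CoxeterSystem M W) {t : W} (ht : cs.IsReflection t) (g u v : W) :
    SeparatesPts cs (g * t * g⁻¹) (g * u) (g * v) ↔ SeparatesPts cs t u v := by
  rw [separatesPts_iff cs ht, separatesPts_iff cs (ht.conj g)]
  rw [show g * t * g⁻¹ * (g * u) = g * (t * u) by group, d_mul_left, d_mul_left]

/-- The reflections in the walls separating `u` from `v`. -/
def wallsBetween (cs : CoxeterSystem M W) (u v : W) : Set W :=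
  {t | cs.IsReflection t ∧ SeparatesPts cs t u v}

theorem image_conj_wallsBetween (cs : CoxeterSystem M W) (u v : W) :
    MulAut.conj u⁻¹ '' wallsBetween cs u v = {t | cs.IsRightInversion (v⁻¹ * u) t} := by
  have key : ∀ t, cs.IsReflection t → (SeparatesPts cs (u * t * u⁻¹) u v ↔
      cs.length (v⁻¹ * u * t) < cs.length (v⁻¹ * u)) := fun t ht ↦ by
    rw [separatesPts_iff cs (ht.conj u), d_comm cs _ v, d_comm cs u v]
    simp [d, mul_assoc]
  ext t
  constructor
  · rintro ⟨t, ⟨ht, hs⟩, rfl⟩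
    have ht' : cs.IsReflection (u⁻¹ * t * u) := by simpa using ht.conj u⁻¹
    have hs' := (key _ ht').1 (by simpa [mul_assoc] using hs)
    have : cs.IsRightInversion (v⁻¹ * u) (u⁻¹ * t * u) := ⟨ht', hs'⟩
    simpa using this
  · rintro ⟨ht, hs⟩
    exact ⟨u * t * u⁻¹, ⟨ht.conj u, (key t ht).2 hs⟩, by simp [mul_assoc]⟩

theorem finite_wallsBetween (cs : CoxeterSystem M W) (u v : W) : (wallsBetween cs u v).Finite :=
  Set.Finite.of_finite_image (image_conj_wallsBetween cs u v ▸ finite_setOf_isRightInversion cs _)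
    (MulEquiv.injective _).injOn

theorem ncard_wallsBetween (cs : CoxeterSystem M W) (u v : W) :
    (wallsBetween cs u v).ncard = d cs u v := by
  rw [← Set.ncard_image_of_injective _ (MulAut.conj u⁻¹).injective, image_conj_wallsBetween,
    ncard_setOf_isRightInversion, d_comm]
  rfl

theorem d_add_d_of_disjoint (cs : CoxeterSystem M W) {u v w : W}
    (h : ∀ t, cs.IsReflection t → SeparatesPts cs t u v → SameSide cs t v w) :
    d cs u v + d cs v w = d cs u w := by
  have hd : Disjoint (wallsBetween cs u v) (wallsBetween cs v w) :=
    Set.disjoint_left.2 fun t hu hv ↦ hv.2 (h t hu.1 hu.2)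
  rw [← ncard_wallsBetween, ← ncard_wallsBetween, ← ncard_wallsBetween,
    ← Set.ncard_union_eq hd (finite_wallsBetween cs _ _) (finite_wallsBetween cs _ _)]
  congr 1
  ext t
  by_cases ht : cs.IsReflection t
  · have := h t ht
    simp only [wallsBetween, SeparatesPts, SameSide, Set.mem_union, Set.mem_ofPred_eq, ht,
      true_and] at this ⊢
    tauto
  · simp [wallsBetween, ht]

end Walls

section Orbit

theorem exists_separatesPts_succ (cs : CoxeterSystem M W) {t : W} {v : ℕ → W} {n : ℕ}
    (h : SeparatesPts cs t (v 0) (v n)) : ∃ i < n, SeparatesPts cs t (v i) (v (i + 1)) := by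
  by_contra! hc
  have key : ∀ m ≤ n, SameSide cs t (v 0) (v m) := by
    intro m
    induction m with
    | zero => exact fun _ ↦ Iff.rfl
    | succ m ih => exact fun hm ↦ (ih (by omega)).trans (not_not.1 (hc m (by omega)))
  exact h (key n le_rfl)

theorem zpow_add_mul (g y : W) (m n : ℤ) : g ^ (m + n) * y = g ^ m * (g ^ n * y) := by
  rw [zpow_add, mul_assoc]

/-- The wall of `t` separates `y` from all but finitely many powers of `g`. -/
def Outside (cs : CoxeterSystem M W) (g t y : W) : Prop :=
  {n : ℤ | SameSide cs t y (g ^ n)}.Finite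

theorem sameSide_conj (cs : CoxeterSystem M W) {t : W} (ht : cs.IsReflection t) (g u v : W) :
    SameSide cs (g * t * g⁻¹) (g * u) (g * v) ↔ SameSide cs t u v :=
  not_iff_not.1 (separatesPts_conj cs ht g u v)

theorem Outside.conj {cs : CoxeterSystem M W} {g t y : W} (ht : cs.IsReflection t)
    (h : Outside cs g t y) (m : ℤ) : Outside cs g (g ^ m * t * (g ^ m)⁻¹) (g ^ m * y) := by
  refine (h.preimage (sub_left_injective (b := m)).injOn).subset fun n hn ↦ ?_
  rw [Set.mem_ofPred_eq, show n = m + (n - m) by ring, zpow_add, sameSide_conj cs ht] at hn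
  exact hn

theorem outside_of_sameSide {cs : CoxeterSystem M W} {g t x y : W} (h : Outside cs g t y)
    (hxy : SameSide cs t y x) : Outside cs g t x :=
  h.subset fun _ hn ↦ hxy.trans hn

theorem finite_outside_zpow (cs : CoxeterSystem M W) (g t : W) :
    {i : ℤ | Outside cs g t (g ^ i)}.Finite := by
  rcases {i : ℤ | Outside cs g t (g ^ i)}.eq_empty_or_nonempty with h | ⟨j, hj⟩
  · rw [h]; exact Set.finite_empty
  · refine hj.subset fun i hi ↦ ?_
    obtain ⟨n, hn⟩ := (Set.Finite.union hj hi).exists_notMem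
    simp only [Set.mem_union, Set.mem_ofPred_eq, SameSide] at hn ⊢
    tauto

theorem finite_outside_one (cs : CoxeterSystem M W) (g : W) :
    {t | cs.IsReflection t ∧ Outside cs g t 1}.Finite := by
  refine ((finite_wallsBetween cs 1 g).biUnion fun t _ ↦
    ((finite_outside_zpow cs g t).preimage neg_injective.injOn).image
      fun i : ℤ ↦ g ^ i * t * (g ^ i)⁻¹).subset ?_
  rintro r ⟨hr, hout⟩
  obtain ⟨n, hn⟩ := (Set.Finite.preimage (Nat.cast_injective (R := ℤ)).injOn hout).exists_notMem
  obtain ⟨i, -, hi⟩ := exists_separatesPts_succ cs (t := r) (v := fun i : ℕ ↦ g ^ (i : ℤ)) (n := n)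
    (by simpa [SeparatesPts] using hn)
  have hc := (separatesPts_conj cs hr (g ^ (-(i : ℤ))) _ _).2 hi
  rw [← zpow_add, ← zpow_add] at hc
  simp only [Set.mem_iUnion]
  refine ⟨_, ⟨hr.conj (g ^ (-(i : ℤ))), ?_⟩, i, ?_, ?_⟩
  · simpa using hc
  · simpa using hout.conj hr (-(i : ℤ))
  · simp [mul_assoc]

theorem injOn_conj_outside (cs : CoxeterSystem M W) (g : W) {t : W} (ht : cs.IsReflection t) :
    Set.InjOn (fun i : ℤ ↦ (g ^ i)⁻¹ * t * g ^ i) {i : ℤ | Outside cs g t (g ^ i)} := by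
  intro m hm m' _ h
  by_contra hne
  have hcomm : Commute (g ^ (m' - m)) t := by
    have h' : (g ^ m)⁻¹ * t * g ^ m = (g ^ m')⁻¹ * t * g ^ m' := h
    rw [Commute, SemiconjBy, sub_eq_add_neg, zpow_add, zpow_neg]
    calc g ^ m' * (g ^ m)⁻¹ * t = g ^ m' * ((g ^ m)⁻¹ * t * g ^ m) * (g ^ m)⁻¹ := by group
      _ = _ := by rw [h']; group
  have hinj : Function.Injective fun l : ℤ ↦ (m' - m) * l + m := fun a b hab ↦ by
    have : (m' - m) * a = (m' - m) * b := by simpa using hab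
    exact mul_left_cancel₀ (sub_ne_zero.2 (Ne.symm hne)) this
  refine Set.infinite_univ (α := ℤ)
    (((finite_outside_zpow cs g t).preimage hinj.injOn).subset fun l _ ↦ ?_)
  have := Outside.conj ht hm ((m' - m) * l)
  have hc : g ^ ((m' - m) * l) * t * (g ^ ((m' - m) * l))⁻¹ = t := by
    rw [zpow_mul, (hcomm.zpow_left l).eq]; simp
  rwa [hc, ← zpow_add] at this

/-- Some vertex lies on the same side as infinitely many powers of `g` for every wall. -/
theorem exists_not_outside (cs : CoxeterSystem M W) (g : W) :
    ∃ y, ∀ t, cs.IsReflection t → ¬ Outside cs g t y := by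
  classical
  set S := (finite_outside_one cs g).toFinset with hS
  set L := ∑ r ∈ S, cs.length r
  set N := S.card * (L + 1) + 1
  let F : W → ℕ := fun y ↦ ∑ i ∈ Finset.range N, d cs y (g ^ (i : ℤ))
  obtain ⟨_, ⟨y, rfl⟩, hy⟩ := wellFounded_lt.has_min (Set.range F) (Set.range_nonempty F)
  refine ⟨y, fun t ht hout ↦ hy (F (t * y)) ⟨_, rfl⟩ ?_⟩
  have hmem : ∀ i : ℤ, SameSide cs t y (g ^ i) → (g ^ i)⁻¹ * t * g ^ i ∈ S := fun i hi ↦ by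
    simpa [hS] using And.intro (ht.conj (g ^ (-i))) ((outside_of_sameSide hout hi).conj ht (-i))
  have hle : ∀ i : ℕ, d cs (t * y) (g ^ (i : ℤ)) + 1 ≤ d cs y (g ^ (i : ℤ)) +
      if SameSide cs t y (g ^ (i : ℤ)) then L + 1 else 0 := by
    intro i
    split_ifs with h
    · have h1 : cs.length ((g ^ (i : ℤ))⁻¹ * t * g ^ (i : ℤ)) ≤ L :=
        Finset.single_le_sum (f := fun r ↦ cs.length r) (fun _ _ ↦ Nat.zero_le _) (hmem i h)
      have h2 := cs.length_mul_le (y⁻¹ * g ^ (i : ℤ)) ((g ^ (i : ℤ))⁻¹ * t * g ^ (i : ℤ))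
      have h3 : y⁻¹ * g ^ (i : ℤ) * ((g ^ (i : ℤ))⁻¹ * t * g ^ (i : ℤ)) =
          (t * y)⁻¹ * g ^ (i : ℤ) := by rw [mul_inv_rev, ht.inv]; group
      rw [h3] at h2
      simp only [d]
      omega
    · exact (separatesPts_iff cs ht _ _).1 h
  have hcard : ((Finset.range N).filter fun i : ℕ ↦ SameSide cs t y (g ^ (i : ℤ))).card ≤
      S.card := by
    refine Finset.card_le_card_of_injOn (fun i : ℕ ↦ (g ^ (i : ℤ))⁻¹ * t * g ^ (i : ℤ))
      (fun i hi ↦ hmem i (Finset.mem_filter.1 hi).2) fun i hi j hj hij ↦ ?_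
    exact Nat.cast_injective (injOn_conj_outside cs g ht
      (outside_of_sameSide hout (Finset.mem_filter.1 hi).2)
      (outside_of_sameSide hout (Finset.mem_filter.1 hj).2) hij)
  have hsum := Finset.sum_le_sum fun i (_ : i ∈ Finset.range N) ↦ hle i
  rw [Finset.sum_add_distrib, Finset.sum_add_distrib, ← Finset.sum_filter, Finset.sum_const,
    Finset.sum_const, Finset.card_range, smul_eq_mul, smul_eq_mul, mul_one] at hsum
  have := Nat.mul_le_mul_right (L + 1) hcard
  change F (t * y) + N ≤ F y + _ at hsum
  omega

theorem exists_commute_or_injective (g t : W) :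
    (∃ p : ℕ, 0 < p ∧ Commute (g ^ p) t) ∨
      Function.Injective fun n : ℤ ↦ (g ^ n)⁻¹ * t * g ^ n := by
  refine or_iff_not_imp_left.2 fun hno ↦ ?_
  have key : ∀ m m' : ℤ, m < m' → (g ^ m)⁻¹ * t * g ^ m ≠ (g ^ m')⁻¹ * t * g ^ m' := by
    intro m m' hlt h
    refine hno ⟨(m' - m).toNat, by omega, ?_⟩
    rw [← zpow_natCast, Int.toNat_of_nonneg (by omega), Commute, SemiconjBy, sub_eq_add_neg,
      zpow_add, zpow_neg]
    calc g ^ m' * (g ^ m)⁻¹ * t = g ^ m' * ((g ^ m)⁻¹ * t * g ^ m) * (g ^ m)⁻¹ := by group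
      _ = _ := by rw [h]; group
  intro m m' h
  rcases lt_trichotomy m m' with hlt | heq | hlt
  · exact (key _ _ hlt h).elim
  · exact heq
  · exact (key _ _ hlt h.symm).elim

theorem finite_separatesPts_zpow (cs : CoxeterSystem M W) {g t : W} (ht : cs.IsReflection t)
    (hinj : Function.Injective fun n : ℤ ↦ (g ^ n)⁻¹ * t * g ^ n) (u v : W) :
    {n : ℤ | SeparatesPts cs t (g ^ n * u) (g ^ n * v)}.Finite := by
  refine ((finite_wallsBetween cs u v).preimage hinj.injOn).subset fun n hn ↦ ?_
  have := (separatesPts_conj cs ht (g ^ n)⁻¹ _ _).2 hn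
  simp only [inv_mul_cancel_left, inv_inv] at this
  exact ⟨by simpa using ht.conj (g ^ n)⁻¹, this⟩

/-- For `y` as in `exists_not_outside`, a wall separates at most one pair of consecutive vertices
of the orbit of `y` under `g ^ k'`, whenever `k'` is divisible by some `k` depending on the wall. -/
theorem exists_dvd_sameSide (cs : CoxeterSystem M W) {g y : W}
    (hy : ∀ t, cs.IsReflection t → ¬ Outside cs g t y) {t : W} (ht : cs.IsReflection t) :
    ∃ k : ℕ, 0 < k ∧ ∀ k' : ℕ, 0 < k' → k ∣ k' → ∀ (a e : ℤ) (j : ℕ), e = a + k' * (j + 1) →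
      SeparatesPts cs t (g ^ a * y) (g ^ (a + k') * y) →
      SameSide cs t (g ^ e * y) (g ^ (e + k') * y) := by
  rcases exists_commute_or_injective g t with ⟨p, hp, hcomm⟩ | hinj
  · refine ⟨2 * p, by omega, ?_⟩
    rintro _ - ⟨q, rfl⟩ a e j - hsep
    refine (hsep ?_).elim
    have hc : g ^ ((p * q : ℕ) : ℤ) * t * (g ^ ((p * q : ℕ) : ℤ))⁻¹ = t := by
      rw [zpow_natCast, pow_mul, (hcomm.pow_left q).eq]; simp
    have h := sameSide_conj cs ht (g ^ ((p * q : ℕ) : ℤ)) (g ^ a * y)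
      (g ^ (((p * q : ℕ) : ℤ) + a) * y)
    rw [hc, ← zpow_add_mul, ← zpow_add_mul] at h
    rw [show a + ((2 * p * q : ℕ) : ℤ) = ((p * q : ℕ) : ℤ) + (((p * q : ℕ) : ℤ) + a) by
      push_cast; ring]
    simp only [SameSide] at h ⊢
    tauto
  · have hD := finite_separatesPts_zpow cs ht hinj y (g * y)
    have hE := finite_separatesPts_zpow cs ht hinj 1 y
    obtain ⟨R, hR⟩ := (hD.image Int.natAbs).bddAbove
    have hstep : ∀ n : ℤ, R < n.natAbs → SameSide cs t (g ^ n * y) (g ^ (n + 1) * y) := by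
      intro n hn
      by_contra h
      refine absurd (hR ⟨n, ?_, rfl⟩) (by omega)
      simpa [SeparatesPts, zpow_add_one, mul_assoc] using h
    set f : ℤ → Prop := fun n ↦ cs.length (t * (g ^ n * y)) < cs.length (g ^ n * y)
    have hpos : ∀ n : ℤ, (R + 1 : ℤ) ≤ n → (f (R + 1) ↔ f n) := by
      intro n hn
      induction n, hn using Int.leInduction with
      | base => rfl
      | succ n hn ih => exact ih.trans (hstep n (by omega))
    have hneg : ∀ n : ℤ, n ≤ (-(R + 1) : ℤ) → (f (-(R + 1)) ↔ f n) := by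
      intro n hn
      induction n, hn using Int.leInductionDown with
      | base => rfl
      | pred n hn ih =>
        have := hstep (n - 1) (by omega)
        rw [sub_add_cancel] at this
        exact ih.trans this.symm
    have hends : (f (R + 1) ↔ f (-(R + 1))) → ∀ b, f b ↔ f (R + 1) := by
      intro h b
      by_contra hb
      have hout : Outside cs g t (g ^ b * y) := by
        refine (hE.union (Set.finite_Ioo (-(R + 1) : ℤ) (R + 1))).subset fun n hn ↦ ?_
        by_contra hn'
        simp only [Set.mem_union, Set.mem_ofPred_eq, Set.mem_Ioo, not_or, mul_one, SeparatesPts,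
          not_not] at hn'
        have h1 : f b ↔ f n := Iff.trans hn hn'.1
        have h2 : f n ↔ f (R + 1) := by
          rcases le_or_gt (R + 1 : ℤ) n with hle | hlt
          · exact (hpos n hle).symm
          · exact (hneg n (by omega)).symm.trans h.symm
        exact hb (h1.trans h2)
      have := hout.conj ht (-b)
      rw [← zpow_add_mul] at this
      exact hy _ (ht.conj (g ^ (-b))) (by simpa using this)
    refine ⟨2 * (R + 1), by omega, fun k' hk' hdvd a e j he hsep ↦ ?_⟩
    have hk := Nat.le_of_dvd hk' hdvd
    change ¬ (f a ↔ f (a + k')) at hsep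
    change f e ↔ f (e + k')
    by_contra hsep'
    have hne : ¬ (f (R + 1) ↔ f (-(R + 1))) := fun h ↦
      hsep ((hends h a).trans (hends h (a + k')).symm)
    have he_lt : e < R + 1 := by
      by_contra! hle
      exact hsep' ((hpos e hle).symm.trans (hpos (e + k') (by omega)))
    have hlt_a : -(R + 1) < a + k' := by
      by_contra! hle
      exact hsep ((hneg a (by omega)).symm.trans (hneg (a + k') hle))
    have hae : a + k' ≤ e := by
      rw [he]
      nlinarith [Int.natCast_nonneg k', Int.natCast_nonneg j]
    have ha := hneg a
    have he' := hpos (e + k') (by omega)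
    rcases j with _ | j
    · obtain rfl : e = a + k' := by rw [he]; push_cast; ring
      have := hneg a (by omega)
      tauto
    · have h0 : (0 : ℤ) ≤ k' * j := by positivity
      have h1 : e = a + k' + k' + k' * j := by rw [he]; push_cast; ring
      omega

/-- Some power of `g` is conjugate to a straight element. -/
theorem exists_straight (cs : CoxeterSystem M W) (g : W) :
    ∃ (k : ℕ) (y : W), 0 < k ∧ ∀ n : ℕ, d cs y (g ^ (k * n) * y) = n * d cs y (g ^ k * y) := by
  obtain ⟨y, hy⟩ := exists_not_outside cs g
  choose! k hk hgood using fun t (ht : cs.IsReflection t) ↦ exists_dvd_sameSide cs hy ht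
  have hA := finite_wallsBetween cs y (g * y)
  set K := ∏ t ∈ hA.toFinset, k t
  have hK : 0 < K := Finset.prod_pos fun t ht ↦ hk t ((hA.mem_toFinset.1 ht).1)
  have hgoodK : ∀ t, cs.IsReflection t → ∀ (a e : ℤ) (j : ℕ), e = a + K * (j + 1) →
      SeparatesPts cs t (g ^ a * y) (g ^ (a + K) * y) →
      SameSide cs t (g ^ e * y) (g ^ (e + K) * y) := by
    intro t ht a e j he hsep
    obtain ⟨i, -, hi⟩ := exists_separatesPts_succ cs (t := t)
      (v := fun i : ℕ ↦ g ^ (a + i) * y) (n := K) (by simpa using hsep)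
    set c : ℤ := a + i
    have hr := ht.conj (g ^ (-c))
    have hmem : g ^ (-c) * t * (g ^ (-c))⁻¹ ∈ hA.toFinset := by
      refine hA.mem_toFinset.2 ⟨hr, ?_⟩
      have h := (separatesPts_conj cs ht (g ^ (-c)) _ _).2 hi
      rw [← zpow_add_mul, ← zpow_add_mul] at h
      simpa [c, ← add_assoc] using h
    have h := hgood _ hr K hK (Finset.dvd_prod_of_mem k hmem) (-c + a) (-c + e) j
      (by rw [he]; ring)
    rw [add_assoc, add_assoc, zpow_add_mul g y (-c), zpow_add_mul g y (-c),
      zpow_add_mul g y (-c), zpow_add_mul g y (-c), separatesPts_conj cs ht,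
      sameSide_conj cs ht] at h
    exact h hsep
  refine ⟨K, y, hK, fun n ↦ ?_⟩
  induction n with
  | zero => simp [d]
  | succ n ih =>
    have hlast : d cs (g ^ (K * n) * y) (g ^ (K * (n + 1)) * y) = d cs y (g ^ K * y) := by
      rw [mul_add_one, pow_add, mul_assoc, d_mul_left]
    rw [← d_add_d_of_disjoint cs (v := g ^ (K * n) * y), ih, hlast]
    · ring
    · intro t ht hsep
      obtain ⟨i, hin, hi⟩ := exists_separatesPts_succ cs (t := t)
        (v := fun i : ℕ ↦ g ^ (K * i) * y) (n := n) (by simpa using hsep)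
      obtain ⟨j, rfl⟩ := Nat.exists_eq_add_of_lt hin
      have h := hgoodK t ht (K * i : ℕ) (K * (i + j + 1) : ℕ) j (by push_cast; ring)
      rw [← Nat.cast_add, ← Nat.cast_add, zpow_natCast, zpow_natCast, zpow_natCast,
        zpow_natCast] at h
      exact h hi

end Orbit

section Line

/-- The periodic edge path line through the powers of `π ω` that repeats the word `ω`. -/
noncomputable def periodicLine (cs : CoxeterSystem M W) (ω : List B) (i : ℤ) : W :=
  cs.wordProd ω ^ (i / ω.length) * cs.wordProd (ω.take (i % ω.length).toNat)

theorem periodicLine_mul_add (cs : CoxeterSystem M W) {ω : List B} (hω : ω ≠ []) (q : ℤ) {r : ℕ}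
    (hr : r ≤ ω.length) :
    periodicLine cs ω (q * ω.length + r) = cs.wordProd ω ^ q * cs.wordProd (ω.take r) := by
  have hpos : (0 : ℤ) < ω.length := by exact_mod_cast List.length_pos_iff.2 hω
  rw [periodicLine, add_comm, Int.add_mul_ediv_right _ _ hpos.ne', Int.add_mul_emod_self_right]
  rcases hr.lt_or_eq with hlt | rfl
  · rw [Int.ediv_eq_zero_of_lt (by omega) (by omega), Int.emod_eq_of_lt (by omega) (by omega)]
    simp
  · rw [Int.ediv_self hpos.ne', Int.emod_self, add_comm, zpow_add_one]
    simp

theorem periodicLine_mul (cs : CoxeterSystem M W) {ω : List B} (hω : ω ≠ []) (q : ℤ) :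
    periodicLine cs ω (q * ω.length) = cs.wordProd ω ^ q := by
  simpa using periodicLine_mul_add cs hω q (Nat.zero_le _)

theorem isLine_periodicLine (cs : CoxeterSystem M W) {ω : List B} (hω : ω ≠ []) :
    IsLine cs (periodicLine cs ω) := by
  intro i
  have hpos : (0 : ℤ) < ω.length := by exact_mod_cast List.length_pos_iff.2 hω
  obtain ⟨r, hr⟩ := Int.eq_ofNat_of_zero_le (Int.emod_nonneg i hpos.ne')
  have hlt : r < ω.length := by exact_mod_cast hr ▸ Int.emod_lt_of_pos i hpos
  have hi : i = i / ω.length * ω.length + r := by rw [← hr, Int.ediv_mul_add_emod]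
  refine ⟨ω[r], ?_⟩
  rw [hi, add_assoc, ← Nat.cast_succ, periodicLine_mul_add cs hω _ hlt.le,
    periodicLine_mul_add cs hω _ hlt, List.take_succ_eq_append_getElem hlt, cs.wordProd_append,
    cs.wordProd_singleton, mul_assoc]

theorem IsLine.d_le {cs : CoxeterSystem M W} {v : ℤ → W} (hv : IsLine cs v) (j : ℤ) (n : ℕ) :
    d cs (v j) (v (j + n)) ≤ n := by
  induction n with
  | zero => simp [d]
  | succ n ih =>
    obtain ⟨i, hi⟩ := hv (j + n)
    have h1 : d cs (v (j + n)) (v (j + n + 1)) = 1 := by simp [d, hi]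
    have := d_triangle cs (v j) (v (j + n)) (v (j + n + 1))
    rw [Nat.cast_succ, ← add_assoc]
    omega

theorem IsLine.isGeodesicLine {cs : CoxeterSystem M W} {v : ℤ → W} (hv : IsLine cs v)
    (h : ∀ n : ℕ, ∃ j k : ℤ, j ≤ -n ∧ n ≤ k ∧ (d cs (v j) (v k) : ℤ) = k - j) :
    IsGeodesicLine cs v := by
  have hle : ∀ j k : ℤ, j ≤ k → (d cs (v j) (v k) : ℤ) ≤ k - j := by
    intro j k hjk
    have := hv.d_le j (k - j).toNat
    rw [Int.toNat_of_nonneg (by omega), add_sub_cancel] at this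
    omega
  refine ⟨hv, fun j k hjk ↦ le_antisymm (hle j k hjk) ?_⟩
  obtain ⟨a, b, ha, hb, hab⟩ := h (j.natAbs + k.natAbs)
  have h1 := hle a j (by omega)
  have h2 := hle k b (by omega)
  have h3 := d_triangle cs (v a) (v j) (v b)
  have h4 := d_triangle cs (v j) (v k) (v b)
  omega

/-- The powers of a straight element lie on a geodesic line. -/
theorem exists_isGeodesicLine_of_straight (cs : CoxeterSystem M W) {z : W} (hz : z ≠ 1)
    (h : ∀ n : ℕ, cs.length (z ^ n) = n * cs.length z) :
    ∃ b : ℤ → W, IsGeodesicLine cs b ∧ ∀ q : ℤ, ∃ m : ℤ, b m = z ^ q := by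
  obtain ⟨ω, hred, rfl⟩ := cs.exists_isReduced z
  have hω : ω ≠ [] := by rintro rfl; simp at hz
  have hpos := List.length_pos_iff.2 hω
  refine ⟨periodicLine cs ω, (isLine_periodicLine cs hω).isGeodesicLine fun n ↦ ?_,
    fun q ↦ ⟨_, periodicLine_mul cs hω q⟩⟩
  refine ⟨-n * ω.length, n * ω.length, by nlinarith, by nlinarith, ?_⟩
  have h2 := h (2 * n)
  rw [hred.eq] at h2
  rw [periodicLine_mul cs hω, periodicLine_mul cs hω, d, ← zpow_neg, ← zpow_add, neg_neg,
    ← two_mul]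
  have : cs.wordProd ω ^ (2 * (n : ℤ)) = cs.wordProd ω ^ (2 * n) := by
    rw [← zpow_natCast]; push_cast; rfl
  rw [this, h2]
  push_cast
  ring

end Line

/-- If `g ∈ W` has infinite order then the set `{…, g⁻¹, 1, g, g², …}` is tracked by a
geodesic edge path line in the Cayley graph `Λ(W,S)`. -/
theorem cyclic_tracked {B : Type*} {W : Type*} [Group W] [Finite B]
    {M : CoxeterMatrix B} (cs : CoxeterSystem M W)
    (g : W) (hg : ¬ IsOfFinOrder g) :
    ∃ (K : ℕ) (b : ℤ → W), IsGeodesicLine cs b ∧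
      ∀ n : ℤ, ∃ m : ℤ, d cs (g ^ n) (b m) ≤ K := by
  obtain ⟨k, y, hk, hstraight⟩ := exists_straight cs g
  have hpow : ∀ n : ℕ, (y⁻¹ * g ^ k * y) ^ n = y⁻¹ * (g ^ (k * n) * y) := fun n ↦ by
    simpa [pow_mul, mul_assoc] using conj_pow (a := y⁻¹) (b := g ^ k) (i := n)
  have hne : y⁻¹ * g ^ k * y ≠ 1 := fun h ↦ hg <| isOfFinOrder_iff_pow_eq_one.2 ⟨k, hk, by
    simpa using conj_eq_one_iff (a := y⁻¹) (b := g ^ k) |>.1 (by simpa using h)⟩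
  obtain ⟨b, ⟨hline, hgeo⟩, hb⟩ := exists_isGeodesicLine_of_straight cs hne fun n ↦ by
    rw [hpow, mul_assoc]; exact hstraight n
  refine ⟨∑ r ∈ Finset.range k, d cs (g ^ r) y, fun i ↦ y * b i, ⟨fun i ↦ ?_, fun i j hij ↦ ?_⟩,
    fun n ↦ ?_⟩
  · obtain ⟨s, hs⟩ := hline i
    exact ⟨s, by simp only [hs, mul_assoc]⟩
  · rw [d_mul_left]; exact hgeo i j hij
  · have hk' : (k : ℤ) ≠ 0 := by omega
    obtain ⟨m, hm⟩ := hb (n / k)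
    obtain ⟨r, hr⟩ := Int.eq_ofNat_of_zero_le (Int.emod_nonneg n hk')
    have hlt : r < k := by exact_mod_cast hr ▸ Int.emod_lt_of_pos n (by omega)
    refine ⟨m, ?_⟩
    have h1 : y * b m = g ^ ((k : ℤ) * (n / k)) * y := by
      have := conj_zpow (a := y⁻¹) (b := g ^ k) (i := n / k)
      rw [inv_inv] at this
      rw [hm, this, zpow_mul, zpow_natCast]
      group
    have h2 : g ^ n = g ^ ((k : ℤ) * (n / k)) * g ^ r := by
      rw [← zpow_natCast g r, ← zpow_add, show (r : ℤ) = n % k from hr.symm, Int.mul_ediv_add_emod]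
    beta_reduce
    rw [h1, h2, d_mul_left]
    exact Finset.single_le_sum (f := fun r ↦ d cs (g ^ r) y) (fun _ _ ↦ Nat.zero_le _)
      (Finset.mem_range.2 hlt)

end CoxTrack
end
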